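/- In the projection+replacement [set-based] total order on set-based judged runs, for every run r the number of runs s with s ≠ ⊥ and s ≼ r equals Σ_{j=0}^{N−1} C((r j : ℕ) + N − 1 − j, N − j), where ⊥ is the all-zero run and C(n, k) denotes the binomial coefficient. Equivalently, the isotone valuations with constant positive weight k on the join-irreducible elements of this chain are exactly M(r) = k · Σ_{j=0}^{N−1} C((r j : ℕ) + N − 1 − j, N − j). -/

import Mathlib

/-- A set-based judged run: relevance degrees listed in decreasing order. -/
abbrev SRun (N c : ℕ) := {r : Fin N → Fin (c + 1) // Antitone r}

/-- The number of documents of `u` with relevance degree exactly `k`. -/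
def cnt {N c : ℕ} (u : SRun N c) (k : Fin (c + 1)) : ℕ :=
  (Finset.univ.filter fun i => u.1 i = k).card

/-- The projection+replacement [set-based] total order: `u ≼ v` iff `u = v` or, at the
largest relevance degree `k` where the counts of `u` and `v` differ, `u` has fewer
documents of degree `k` than `v`. -/
def prLE {N c : ℕ} (u v : SRun N c) : Prop :=
  u = v ∨ ∃ k : Fin (c + 1), cnt u k < cnt v k ∧ ∀ j : Fin (c + 1), k < j → cnt u j = cnt v j

/-- The all-zero run, bottom of the projection+replacement [set-based] order. -/
def zeroRun (N c : ℕ) : SRun N c := ⟨fun _ => 0, fun _ _ _ => le_rfl⟩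

/-- Strict lexicographic comparison, with the position of first difference. -/
def lexAt {N c : ℕ} (s r : SRun N c) (j : Fin N) : Prop :=
  (∀ i, i < j → s.1 i = r.1 i) ∧ s.1 j < r.1 j

def strictPR {N c : ℕ} (u v : SRun N c) : Prop :=
  ∃ k : Fin (c + 1), cnt u k < cnt v k ∧ ∀ j : Fin (c + 1), k < j → cnt u j = cnt v j

lemma strict_of_lexAt {N c : ℕ} {s r : SRun N c} {j : Fin N} (h : lexAt s r j) :
    strictPR s r := by
  obtain ⟨h1, h2⟩ := h
  refine ⟨r.1 j, ?_, ?_⟩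
  · apply Finset.card_lt_card
    rw [Finset.ssubset_iff_of_subset]
    · exact ⟨j, by simp, by simp [h2.ne]⟩
    · intro i hi
      simp only [Finset.mem_filter, Finset.mem_univ, true_and] at hi ⊢
      by_cases hij : i < j
      · rw [← h1 i hij, hi]
      · have := s.2 (not_lt.1 hij)
        rw [hi] at this
        exact absurd h2 (not_lt.2 this)
  · intro d hd
    unfold cnt
    congr 1
    ext i
    simp only [Finset.mem_filter, Finset.mem_univ, true_and]
    by_cases hij : i < j
    · rw [h1 i hij]
    · have a := s.2 (not_lt.1 hij)
      have b := r.2 (not_lt.1 hij)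
      constructor
      · intro e
        rw [e] at a
        exact absurd (a.trans_lt (h2.trans hd)) (lt_irrefl _)
      · intro e
        rw [e] at b
        exact absurd (b.trans_lt hd) (lt_irrefl _)

lemma strict_asymm {N c : ℕ} {s r : SRun N c} (h : strictPR s r) (h' : strictPR r s) : False := by
  obtain ⟨k, h1, h2⟩ := h
  obtain ⟨l, h3, h4⟩ := h'
  rcases lt_trichotomy k l with h | h | h
  · have := h2 l h; omega
  · subst h; omega
  · have := h4 k h; omega

lemma lex_total {N c : ℕ} {s r : SRun N c} (h : s ≠ r) :
    (∃ j, lexAt s r j) ∨ ∃ j, lexAt r s j := by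
  have hne : (Finset.univ.filter fun i => s.1 i ≠ r.1 i).Nonempty := by
    by_contra hh
    apply h
    apply Subtype.ext
    funext i
    by_contra hi
    exact hh ⟨i, by simpa using hi⟩
  have hmem := Finset.min'_mem _ hne
  have hmin := fun i hi => Finset.min'_le (Finset.univ.filter fun i => s.1 i ≠ r.1 i) i hi
  set j := Finset.min' _ hne
  have hj : s.1 j ≠ r.1 j := by simpa using hmem
  have hb : ∀ i, i < j → s.1 i = r.1 i := by
    intro i hi
    by_contra hc
    exact absurd (hmin i (by simpa using hc)) (not_le.2 hi)
  rcases lt_or_gt_of_ne hj with h | h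
  · exact Or.inl ⟨j, hb, h⟩
  · exact Or.inr ⟨j, fun i hi => (hb i hi).symm, h⟩

lemma prLE_iff {N c : ℕ} {s r : SRun N c} : prLE s r ↔ s = r ∨ ∃ j, lexAt s r j := by
  constructor
  · rintro (h | h)
    · exact Or.inl h
    · by_cases e : s = r
      · exact Or.inl e
      · rcases lex_total e with h' | ⟨j, h'⟩
        · exact Or.inr h'
        · exact (strict_asymm h (strict_of_lexAt h')).elim
  · rintro (h | ⟨j, h⟩)
    · exact Or.inl h
    · exact Or.inr (strict_of_lexAt h)

/-- Antitone sequences of length `n` with values `< m`. -/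
abbrev Anti (n m : ℕ) := {f : Fin n → ℕ // Antitone f ∧ ∀ i, f i < m}

instance (n m : ℕ) : Finite (Anti n m) :=
  Finite.of_injective (β := Fin n → Fin m) (fun f i => ⟨f.1 i, f.2.2 i⟩) (by
    intro f g h
    apply Subtype.ext
    funext i
    simpa using congrFun h i)

def stepMap (n m : ℕ) : Anti (n + 1) m ⊕ Anti n (m + 1) → Anti (n + 1) (m + 1)
  | Sum.inl f => ⟨f.1, f.2.1, fun i => (f.2.2 i).trans (Nat.lt_succ_self m)⟩
  | Sum.inr g => ⟨Fin.cons m g.1, by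
      constructor
      · intro a b hab
        refine Fin.cases ?_ (fun b => ?_) b a hab
        · intro a hab
          have : a = 0 := by simpa using hab
          simp [this]
        · intro a hab
          induction a using Fin.cases with
          | zero => simpa using Nat.lt_succ_iff.1 (g.2.2 b)
          | succ a => simpa using g.2.1 (by simpa using hab)
      · intro i
        induction i using Fin.cases with
        | zero => simp
        | succ i => simpa using g.2.2 i⟩

lemma stepMap_bij (n m : ℕ) : Function.Bijective (stepMap n m) := by
  constructor
  · rintro (f | f) (g | g) h
    · have := congrArg Subtype.val h
      exact congrArg Sum.inl (Subtype.ext this)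
    · have := congrFun (congrArg Subtype.val h) 0
      have h2 := f.2.2 0
      simp [stepMap] at this
      omega
    · have := congrFun (congrArg Subtype.val h) 0
      have h2 := g.2.2 0
      simp [stepMap] at this
      omega
    · have := congrArg Subtype.val h
      simp only [stepMap] at this
      exact congrArg Sum.inr (Subtype.ext (Fin.cons_right_injective _ this))
  · intro f
    by_cases h : f.1 0 = m
    · refine ⟨Sum.inr ⟨fun i => f.1 i.succ, ?_, fun i => f.2.2 _⟩, ?_⟩
      · intro a b hab
        exact f.2.1 (by simpa using hab)
      · apply Subtype.ext
        funext i
        induction i using Fin.cases with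
        | zero => simp [stepMap, h]
        | succ i => simp [stepMap]
    · refine ⟨Sum.inl ⟨f.1, f.2.1, fun i => ?_⟩, rfl⟩
      have h1 := f.2.1 (Fin.zero_le i)
      have h2 := f.2.2 0
      omega

lemma card_anti (n m : ℕ) : Nat.card (Anti n m) = Nat.multichoose m n := by
  induction n generalizing m with
  | zero =>
    have : Unique (Anti 0 m) :=
      { default := ⟨Fin.elim0, fun a => a.elim0, fun a => a.elim0⟩
        uniq := fun f => Subtype.ext (funext fun a => a.elim0) }
    simp
  | succ n ihn =>
    induction m with
    | zero =>
      have : IsEmpty (Anti (n + 1) 0) := ⟨fun f => absurd (f.2.2 0) (by omega)⟩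
      simp
    | succ m ihm =>
      rw [← Nat.card_eq_of_bijective _ (stepMap_bij n m), Nat.card_sum, ihm, ihn,
        Nat.multichoose_succ_succ]

lemma card_lexAt {N c : ℕ} (r : SRun N c) (j : Fin N) :
    Nat.card {s : SRun N c // lexAt s r j} =
      Nat.choose ((r.1 j : ℕ) + N - 1 - (j : ℕ)) (N - (j : ℕ)) := by
  have key : Nat.card {s : SRun N c // lexAt s r j} = Nat.card (Anti (N - j) (r.1 j)) := by
    refine Nat.card_eq_of_bijective (fun s => (⟨fun i => (s.1.1 ⟨j + i, by omega⟩ : ℕ), ?_, ?_⟩ :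
      Anti (N - j) (r.1 j))) ⟨?_, ?_⟩
    · intro a b hab
      apply s.1.2
      simpa using hab
    · intro i
      have h1 : s.1.1 ⟨j + i, by omega⟩ ≤ s.1.1 j := s.1.2 (by simp [Fin.le_def])
      exact h1.trans_lt s.2.2
    · intro s t h
      apply Subtype.ext
      apply Subtype.ext
      funext i
      by_cases hij : i < j
      · rw [s.2.1 i hij, t.2.1 i hij]
      · have hle : (j : ℕ) ≤ i := not_lt.1 hij
        have := congrFun (congrArg Subtype.val h) ⟨i - j, by omega⟩
        simp only at this
        apply Fin.ext
        convert this using 4 <;> omega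
    · intro f
      have hf : ∀ i, f.1 i < c + 1 := fun i => (f.2.2 i).trans (r.1 j).2
      refine ⟨⟨⟨fun i => if h : i < j then r.1 i else ⟨f.1 ⟨i - j, by omega⟩, hf _⟩, ?_⟩, ?_, ?_⟩, ?_⟩
      · intro a b hab
        dsimp only
        by_cases hb : b < j
        · have ha : a < j := hab.trans_lt hb
          rw [dif_pos hb, dif_pos ha]
          exact r.2 hab
        · rw [dif_neg hb]
          by_cases ha : a < j
          · rw [dif_pos ha]
            have h1 := r.2 ha.le
            exact (Fin.lt_def.2 (f.2.2 _)).le.trans h1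
          · rw [dif_neg ha]
            apply f.2.1
            rw [Fin.le_def] at hab ⊢
            dsimp only
            omega
      · intro i hi
        simp [hi]
      · simp only [lt_irrefl, dite_false]
        exact f.2.2 _
      · apply Subtype.ext
        funext i
        have : ¬ ((⟨j + i, by omega⟩ : Fin N) < j) := by simp [Fin.lt_def]
        simp [this]
  rw [key, card_anti, Nat.multichoose_eq]
  congr 1
  omega

open Classical in
lemma card_main {N c : ℕ} (r : SRun N c) :
    Nat.card {s : SRun N c // s ≠ zeroRun N c ∧ prLE s r}
        = ∑ j : Fin N, Nat.choose ((r.1 j : ℕ) + N - 1 - (j : ℕ)) (N - (j : ℕ)) := by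
  have e1 : (Finset.univ.filter fun s : SRun N c => s ≠ zeroRun N c ∧ prLE s r) =
      (insert r (Finset.univ.filter fun s : SRun N c => ∃ j, lexAt s r j)).erase (zeroRun N c) := by
    ext s
    simp [prLE_iff]
  have h0 : zeroRun N c ∈ insert r (Finset.univ.filter fun s : SRun N c => ∃ j, lexAt s r j) := by
    simp only [Finset.mem_insert, Finset.mem_filter, Finset.mem_univ, true_and]
    by_cases h : zeroRun N c = r
    · exact Or.inl h
    · rcases lex_total h with h | ⟨j, h⟩
      · exact Or.inr h
      · exact absurd h.2 (not_lt.2 (Fin.zero_le _))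
  have hr : r ∉ (Finset.univ.filter fun s : SRun N c => ∃ j, lexAt s r j) := by
    intro h
    obtain ⟨j, h⟩ := (Finset.mem_filter.1 h).2
    exact lt_irrefl _ h.2
  have e2 : (Finset.univ.filter fun s : SRun N c => ∃ j, lexAt s r j) =
      Finset.univ.biUnion fun j => Finset.univ.filter fun s : SRun N c => lexAt s r j := by
    ext s
    simp
  rw [Nat.card_eq_fintype_card, Fintype.card_subtype, e1, Finset.card_erase_of_mem h0,
    Finset.card_insert_of_notMem hr, Nat.add_sub_cancel, e2, Finset.card_biUnion]
  · apply Finset.sum_congr rfl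
    intro j _
    rw [← card_lexAt, Nat.card_eq_fintype_card, Fintype.card_subtype]
  · intro a _ b _ hab
    refine Finset.disjoint_left.2 ?_
    intro s hs ht
    simp only [Finset.mem_filter, Finset.mem_univ, true_and] at hs ht
    rcases lt_or_gt_of_ne hab with h | h
    · exact absurd (ht.1 a h) hs.2.ne
    · exact absurd (hs.1 b h) ht.2.ne

/-- In the projection+replacement [set-based] chain, the number of runs `s ≠ ⊥` with
`s ≼ r` equals `Σ_j C((r j) + N − 1 − j, N − j)`; equivalently, the isotone valuations
with constant positive weight `k` on the join-irreducible elements of this chain are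
exactly `M(r) = k · Σ_j C((r j) + N − 1 − j, N − j)`. -/
theorem setBased_projRepl_count (N c : ℕ) (hN : 1 ≤ N) (hc : 1 ≤ c) (r : SRun N c) :
    Nat.card {s : SRun N c // s ≠ zeroRun N c ∧ prLE s r}
        = ∑ j : Fin N, Nat.choose ((r.1 j : ℕ) + N - 1 - (j : ℕ)) (N - (j : ℕ)) ∧
    ∀ k : ℝ, 0 < k →
      k * (Nat.card {s : SRun N c // s ≠ zeroRun N c ∧ prLE s r} : ℝ)
        = k * ∑ j : Fin N, (Nat.choose ((r.1 j : ℕ) + N - 1 - (j : ℕ)) (N - (j : ℕ)) : ℝ) := by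
  refine ⟨card_main r, fun k _ => ?_⟩
  rw [card_main r]
  push_cast
  rfl
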